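/- Let L be a lattice without infinite descending chains and h : L → K a surjective lattice homomorphism. Then for every x ∈ K the set h⁻¹{x} has a least element β(x), and the resulting map β : K → L is a join-homomorphism (the lower adjoint of h) satisfying h ∘ β = id_K. -/

import Mathlib

/-- If `L` is a lattice with no infinite descending chains (well-founded `<`)
and `h : L → K` is a surjective lattice homomorphism, then every fiber
`h⁻¹{x}` has a least element `β x`, and `β` is a join-homomorphism (the lower
adjoint of `h`) with `h ∘ β = id`. -/
theorem lower_adjoint_of_surjective_wellFounded
    {L K : Type*} [Lattice L] [Lattice K] [WellFoundedLT L]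
    (h : LatticeHom L K) (hsurj : Function.Surjective h) :
    ∃ β : K → L,
      (∀ x : K, IsLeast {y : L | h y = x} (β x)) ∧
      (∀ x y : K, β (x ⊔ y) = β x ⊔ β y) ∧
      h ∘ β = id := by
  have key : ∀ x : K, ∃ b : L, IsLeast {y : L | h y = x} b := by
    intro x
    obtain ⟨b, hb, hmin⟩ :=
      (wellFounded_lt (α := L)).has_min {y : L | h y = x} (hsurj x)
    have hb' : h b = x := hb
    refine ⟨b, hb, ?_⟩
    intro y hy
    have hy' : h y = x := hy
    have hmem : h (b ⊓ y) = x := by rw [map_inf, hb', hy', inf_idem]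
    have hn := hmin (b ⊓ y) hmem
    by_contra hc
    exact hn (inf_lt_left.mpr hc)
  choose β hβ using key
  have hβ1 : ∀ x, h (β x) = x := fun x => (hβ x).1
  -- the Galois connection between `β` and `h`
  have gc : GaloisConnection β h := by
    intro x l
    constructor
    · intro hl
      have := OrderHomClass.mono h hl
      rwa [hβ1] at this
    · intro hl
      have hmem : h (β x ⊓ l) = x := by rw [map_inf, hβ1, inf_eq_left.mpr hl]
      exact ((hβ x).2 hmem).trans inf_le_right
  exact ⟨β, hβ, fun x y => gc.l_sup, funext hβ1⟩
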